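/- arXiv:hep-th/0508155 — 3 statements merged into one kernel-verified Lean document; each statement's English description precedes it below -/
import Mathlib

section
/- Let (A,R) be a Rota–Baxter algebra of weight one with A commutative, R̃ := id_A − R, n ≥ 1, and let a ∈ M_n(A) be strictly upper triangular. Then the equation b' = 1 − 𝓡̃(a·b') has a unique solution b' ∈ M_n(A), where 𝓡̃ applies R̃ entrywise and 1 is the identity matrix; moreover this solution b' is unipotent upper triangular. -/
namespace Matrix

/-- The entries in row `i` of `a * b`, for strictly upper triangular `a`, depend only on the rows
of `b` below row `i`. -/
theorem mul_apply_congr_of_strictUpper {A : Type*} [CommRing A] {n : ℕ}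
    {a b c : Matrix (Fin n) (Fin n) A} (ha : ∀ i j : Fin n, j ≤ i → a i j = 0) {i : Fin n}
    (j : Fin n) (h : ∀ k, i < k → b k j = c k j) : (a * b) i j = (a * c) i j := by
  rw [mul_apply, mul_apply]
  refine Finset.sum_congr rfl fun k _ => ?_
  rcases le_or_gt k i with hk | hk
  · simp [ha i k hk]
  · rw [h k hk]

/-- After `k` iterations of `x ↦ 1 - S (a * x)` with `a` strictly upper triangular, the last `k`
rows no longer depend on the starting matrix. -/
theorem iterate_one_sub_map_mul_apply_eq {A : Type*} [CommRing A] {n : ℕ} (S : A → A)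
    {a : Matrix (Fin n) (Fin n) A} (ha : ∀ i j : Fin n, j ≤ i → a i j = 0)
    (b c : Matrix (Fin n) (Fin n) A) (k : ℕ) (i j : Fin n) (hi : n ≤ i + k) :
    (fun x => 1 - (a * x).map S)^[k] b i j = (fun x => 1 - (a * x).map S)^[k] c i j := by
  induction k generalizing i with
  | zero => omega
  | succ k ih =>
    simp only [Function.iterate_succ_apply', sub_apply, map_apply]
    rw [mul_apply_congr_of_strictUpper ha j fun l hl => ih l (by omega)]

theorem existsUnique_eq_one_sub_map_mul {A : Type*} [CommRing A] {n : ℕ} (S : A → A)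
    {a : Matrix (Fin n) (Fin n) A} (ha : ∀ i j : Fin n, j ≤ i → a i j = 0) :
    ∃! b : Matrix (Fin n) (Fin n) A, b = 1 - (a * b).map S := by
  set T : Matrix (Fin n) (Fin n) A → Matrix (Fin n) (Fin n) A := fun x => 1 - (a * x).map S
    with hT
  have hconst (b c) : T^[n] b = T^[n] c := by
    ext i j
    exact iterate_one_sub_map_mul_apply_eq S ha b c n i j (by omega)
  refine ⟨T^[n] 0, ?_, fun b hb => ?_⟩
  · change T^[n] 0 = T (T^[n] 0)
    rw [← Function.iterate_succ_apply' T, Function.iterate_succ_apply]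
    exact hconst _ _
  · rw [← hconst b 0, Function.iterate_fixed (f := T) hb.symm]

theorem sub_one_apply_eq_zero_of_eq_one_sub_map_mul {A : Type*} [CommRing A] {n : ℕ} {S : A → A}
    (hS : S 0 = 0) {a b : Matrix (Fin n) (Fin n) A} (ha : ∀ i j : Fin n, j ≤ i → a i j = 0)
    (hb : b = 1 - (a * b).map S) (i j : Fin n) (hij : j ≤ i) : (b - 1) i j = 0 := by
  induction i using WellFoundedGT.induction with
  | ind i ih =>
    have hrow : (a * b) i j = (a * (0 : Matrix (Fin n) (Fin n) A)) i j :=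
      mul_apply_congr_of_strictUpper ha j fun k hk => by
        have := ih k hk (hij.trans hk.le)
        rwa [sub_apply, one_apply_ne (hij.trans_lt hk).ne', sub_zero] at this
    rw [hb]
    simp [hrow, hS]

end Matrix

/-- Let `(A,R)` be a commutative Rota–Baxter algebra of weight one,
`R̃ := id − R`, `n ≥ 1`, and `a ∈ M_n(A)` strictly upper triangular. Then the equation
`b' = 1 − 𝓡̃(a·b')` (with `𝓡̃` the entrywise extension of `R̃`) has a unique solution
in `M_n(A)`, and any solution is unipotent upper triangular. -/
theorem matrix_renormalized_eq_unique_sol {K A : Type*} [Field K] [CharZero K] [CommRing A]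
    [Algebra K A] (R : A →ₗ[K] A)
    (hR : ∀ x y : A, R x * R y + R (x * y) = R (R x * y + x * R y))
    (n : ℕ) (hn : 1 ≤ n)
    (a : Matrix (Fin n) (Fin n) A)
    (ha : ∀ i j : Fin n, j ≤ i → a i j = 0) :
    (∃! b' : Matrix (Fin n) (Fin n) A, b' = 1 - (a * b').map (fun x => x - R x)) ∧
    (∀ b' : Matrix (Fin n) (Fin n) A, b' = 1 - (a * b').map (fun x => x - R x) →
      ∀ i j : Fin n, j ≤ i → (b' - 1) i j = 0) := by
  exact ⟨Matrix.existsUnique_eq_one_sub_map_mul _ ha, fun _ hb =>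
    Matrix.sub_one_apply_eq_zero_of_eq_one_sub_map_mul (by simp) ha hb⟩
end

section
/- Let (A,R) be a Rota–Baxter algebra of weight one with A commutative, R̃ := id_A − R, n ≥ 1, and let a ∈ M_n(A) be strictly upper triangular. Let b ∈ M_n(A) be the unique solution of b = 1 − 𝓡(b·a) and b' ∈ M_n(A) the unique solution of b' = 1 − 𝓡̃(a·b'). Then b and b' are invertible with b^{-1} = 1 + 𝓡(a·b') and b'^{-1} = 1 + 𝓡̃(b·a). -/
/-- Applying a Rota–Baxter operator of weight one entrywise to matrices gives again a
Rota–Baxter operator of weight one. -/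
theorem Matrix.map_rotaBaxter {A m : Type*} [Ring A] [Fintype m] (R : A →+ A)
    (hR : ∀ x y : A, R x * R y + R (x * y) = R (R x * y + x * R y)) (x y : Matrix m m A) :
    x.map R * y.map R + (x * y).map R = (x.map R * y + x * y.map R).map R := by
  ext i j
  simp only [Matrix.add_apply, Matrix.mul_apply, Matrix.map_apply, map_sum,
    ← Finset.sum_add_distrib, hR]

/-- The product of the images of `b * a` and `a * b'` under a Rota–Baxter operator, for
solutions `b`, `b'` of the two Atkinson recursions. -/
theorem rotaBaxter_map_mul_map {S : Type*} [Ring S] (P : S →+ S)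
    (hP : ∀ x y : S, P x * P y + P (x * y) = P (P x * y + x * P y))
    {a b b' : S} (hb : b = 1 - P (b * a)) (hb' : b' = 1 - (a * b' - P (a * b'))) :
    P (b * a) * P (a * b') = P (a * b') - P (b * a) := by
  have h1 : P (b * a) = 1 - b := by rw [eq_sub_iff_add_eq, ← eq_sub_iff_add_eq']; exact hb
  have h2 : P (a * b') = b' - 1 + a * b' := by
    calc P (a * b') = (1 - (a * b' - P (a * b'))) - 1 + a * b' := by abel
      _ = b' - 1 + a * b' := by rw [← hb']
  have h3 : P (b * a) * (a * b') + b * a * P (a * b') =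
      a * b' - b * a + b * a * (a * b') := by
    rw [h1, h2]; noncomm_ring
  have h4 := hP (b * a) (a * b')
  rw [h3, map_add, map_sub] at h4
  exact add_right_cancel h4

/-- Atkinson factorization: the right inverse of `b`. -/
theorem rotaBaxter_mul_one_add {S : Type*} [Ring S] (P : S →+ S)
    (hP : ∀ x y : S, P x * P y + P (x * y) = P (P x * y + x * P y))
    {a b b' : S} (hb : b = 1 - P (b * a)) (hb' : b' = 1 - (a * b' - P (a * b'))) :
    b * (1 + P (a * b')) = 1 := by
  have h := rotaBaxter_map_mul_map P hP hb hb'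
  calc b * (1 + P (a * b')) = (1 - P (b * a)) * (1 + P (a * b')) := by rw [← hb]
    _ = 1 - P (b * a) + P (a * b') - P (b * a) * P (a * b') := by noncomm_ring
    _ = 1 := by rw [h]; abel

/-- Atkinson factorization: the left inverse of `b'`. -/
theorem rotaBaxter_one_add_mul {S : Type*} [Ring S] (P : S →+ S)
    (hP : ∀ x y : S, P x * P y + P (x * y) = P (P x * y + x * P y))
    {a b b' : S} (hb : b = 1 - P (b * a)) (hb' : b' = 1 - (a * b' - P (a * b'))) :
    (1 + (b * a - P (b * a))) * b' = 1 := by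
  have h := rotaBaxter_mul_one_add P hP hb hb'
  have h1 : 1 + (b * a - P (b * a)) = b * (1 + a) := by
    calc 1 + (b * a - P (b * a)) = (1 - P (b * a)) + b * a := by abel
      _ = b * (1 + a) := by rw [← hb]; noncomm_ring
  have h2 : (1 + a) * b' = 1 + P (a * b') := by
    calc (1 + a) * b' = b' + a * b' := by noncomm_ring
      _ = (1 - (a * b' - P (a * b'))) + a * b' := by rw [← hb']
      _ = 1 + P (a * b') := by abel
  rw [h1, mul_assoc, h2, h]

/-- Let `(A,R)` be a commutative Rota–Baxter algebra of weight one,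
`R̃ := id − R`, `n ≥ 1`, `a ∈ M_n(A)` strictly upper triangular. If `b` solves
`b = 1 − 𝓡(b·a)` and `b'` solves `b' = 1 − 𝓡̃(a·b')`, then `b` and `b'` are invertible
with `b⁻¹ = 1 + 𝓡(a·b')` and `b'⁻¹ = 1 + 𝓡̃(b·a)`. -/
theorem matrix_inverses_formula {K A : Type*} [Field K] [CharZero K]
    [CommRing A] [Algebra K A] (R : A →ₗ[K] A)
    (hR : ∀ x y : A, R x * R y + R (x * y) = R (R x * y + x * R y))
    (n : ℕ) (hn : 1 ≤ n)
    (a : Matrix (Fin n) (Fin n) A)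
    (ha : ∀ i j : Fin n, j ≤ i → a i j = 0)
    (b b' : Matrix (Fin n) (Fin n) A)
    (hb : b = 1 - (b * a).map ⇑R)
    (hb' : b' = 1 - (a * b').map (fun x => x - R x)) :
    IsUnit b ∧ IsUnit b' ∧
    b⁻¹ = 1 + (a * b').map ⇑R ∧
    b'⁻¹ = 1 + (b * a).map (fun x => x - R x) := by
  have hP := Matrix.map_rotaBaxter (m := Fin n) R.toAddMonoidHom hR
  have h1 := rotaBaxter_mul_one_add (a := a) (b := b) (b' := b')
    R.toAddMonoidHom.mapMatrix hP hb hb'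
  have h2 := rotaBaxter_one_add_mul (a := a) (b := b) (b' := b')
    R.toAddMonoidHom.mapMatrix hP hb hb'
  exact ⟨IsUnit.of_mul_eq_one _ h1, IsUnit.of_mul_eq_one_right _ h2,
    Matrix.inv_eq_right_inv h1, Matrix.inv_eq_left_inv h2⟩
end

section
/- Let (A,R) be a Rota–Baxter algebra of weight one with A commutative, R̃ := id_A − R, n ≥ 1, and let α ∈ M_n(A) be unipotent upper triangular. Then the unique solution β' ∈ M_n(A) of the equation β' = 1 − 𝓡̃(β'·(α − 1)) is given entrywise by: β'_{ij} = 0 for i > j, β'_{ii} = 1, and for i < j, β'_{ij} = −R̃(α_{ij}) − Σ_{k=2}^{j−i} Σ_{i < l₁ < l₂ < ⋯ < l_{k−1} < j} (−1)^{k+1} R̃(R̃(⋯ R̃(R̃(α_{i l₁}) α_{l₁ l₂}) ⋯ α_{l_{k−2} l_{k−1}}) α_{l_{k−1} j}), where the inner sum runs over all strictly increasing chains i < l₁ < ⋯ < l_{k−1} < j of indices. -/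
/-- Auxiliary accumulator for the left-nested Rota–Baxter word:
`nestedLAux Rt α x i ls j` continues building
`Rt(⋯ Rt(x · α_{i l}) ⋯ α_{l' j})` along the chain `ls`. -/
def nestedLAux {n : ℕ} {A : Type*} [CommRing A] (Rt : A → A)
    (α : Matrix (Fin n) (Fin n) A) : A → Fin n → List (Fin n) → Fin n → A
  | x, i, [], j => Rt (x * α i j)
  | x, i, l :: ls, j => nestedLAux Rt α (Rt (x * α i l)) l ls j

/-- The left-nested Rota–Baxter word associated to a chain `i, l₁, …, l_{k−1}, j`:
`nestedL Rt α i [l₁, …, l_{k−1}] j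
  = Rt(Rt(⋯ Rt(Rt(α_{i l₁}) α_{l₁ l₂}) ⋯ α_{l_{k−2} l_{k−1}}) α_{l_{k−1} j})`,
with `nestedL Rt α i [] j = Rt(α_{ij})`. -/
def nestedL {n : ℕ} {A : Type*} [CommRing A] (Rt : A → A)
    (α : Matrix (Fin n) (Fin n) A) : Fin n → List (Fin n) → Fin n → A
  | i, [], j => Rt (α i j)
  | i, l :: ls, j => nestedLAux Rt α (Rt (α i l)) l ls j

section Helpers

open Finset

variable {n : ℕ} {A : Type*} [CommRing A]

theorem nestedLAux_append_singleton (Rt : A → A) (α : Matrix (Fin n) (Fin n) A)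
    (x : A) (i : Fin n) (ls : List (Fin n)) (k j : Fin n) :
    nestedLAux Rt α x i (ls ++ [k]) j = Rt (nestedLAux Rt α x i ls k * α k j) := by
  induction ls generalizing x i with
  | nil => simp [nestedLAux]
  | cons l ls ih => simp [nestedLAux, ih]

theorem nestedL_append_singleton (Rt : A → A) (α : Matrix (Fin n) (Fin n) A)
    (i : Fin n) (ls : List (Fin n)) (k j : Fin n) :
    nestedL Rt α i (ls ++ [k]) j = Rt (nestedL Rt α i ls k * α k j) := by
  cases ls with
  | nil => simp [nestedL, nestedLAux]
  | cons l ls => simp [nestedL, nestedLAux_append_singleton]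

theorem Finset.sort_insert_of_forall_lt {ι : Type*} [LinearOrder ι] {S : Finset ι} {k : ι}
    (h : ∀ x ∈ S, x < k) :
    (insert k S).sort (· ≤ ·) = S.sort (· ≤ ·) ++ [k] := by
  have hk : k ∉ S := fun hk => lt_irrefl _ (h k hk)
  refine List.Perm.eq_of_pairwise (le := (· ≤ ·)) (fun a b _ _ => le_antisymm)
    (pairwise_sort _ _) ?_ ?_
  · refine List.pairwise_append.2 ⟨pairwise_sort _ _, List.pairwise_singleton _ _, ?_⟩
    intro a ha b hb
    rw [List.mem_singleton.1 hb]
    exact (h a (by simpa using ha)).le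
  · rw [← Multiset.coe_eq_coe]
    rw [← Multiset.coe_add, sort_eq, sort_eq, insert_val_of_notMem hk, Multiset.coe_singleton,
      add_comm, Multiset.singleton_add]

/-- Subsets of `Ioo i j` are classified by their greatest element. -/
theorem Finset.sum_powerset_Ioo_eq {ι M : Type*} [LinearOrder ι] [LocallyFiniteOrder ι]
    [AddCommMonoid M] (i j : ι) (g : Finset ι → M) :
    ∑ S ∈ (Ioo i j).powerset, g S =
      g ∅ + ∑ k ∈ Ioo i j, ∑ S ∈ (Ioo i k).powerset, g (insert k S) := by
  rw [← Finset.add_sum_erase _ _ (Finset.empty_mem_powerset (Ioo i j)), Finset.sum_sigma']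
  congr 1
  symm
  refine Finset.sum_bij (fun p _ => insert p.1 p.2) ?_ ?_ ?_ (fun _ _ => rfl)
  · rintro ⟨k, S⟩ h
    simp only [mem_sigma, mem_Ioo, mem_powerset, subset_iff] at h
    simp only [mem_erase, ne_eq, insert_ne_empty, not_false_eq_true, mem_powerset, subset_iff,
      mem_insert, mem_Ioo, true_and]
    rintro x (rfl | hx)
    · exact h.1
    · exact ⟨(h.2 hx).1, (h.2 hx).2.trans h.1.2⟩
  · rintro ⟨k, S⟩ h ⟨l, T⟩ h' e
    simp only [mem_sigma, mem_Ioo, mem_powerset, subset_iff] at h h' e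
    have hkS : k ∉ S := fun hk => lt_irrefl _ (h.2 hk).2
    have hlT : l ∉ T := fun hl => lt_irrefl _ (h'.2 hl).2
    have hkl : k = l := by
      have h1 : k ∈ insert l T := e ▸ mem_insert_self k S
      have h2 : l ∈ insert k S := e ▸ mem_insert_self l T
      rcases mem_insert.1 h1 with h1 | h1
      · exact h1
      rcases mem_insert.1 h2 with h2 | h2
      · exact h2.symm
      exact absurd ((h.2 h2).2.trans (h'.2 h1).2) (lt_irrefl _)
    subst hkl
    have : S = T := by rw [← erase_insert hkS, e, erase_insert hlT]
    rw [this]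
  · intro S hS
    rw [mem_erase, mem_powerset] at hS
    have hne := nonempty_iff_ne_empty.2 hS.1
    have hm := S.max'_mem hne
    refine ⟨⟨S.max' hne, S.erase (S.max' hne)⟩, ?_, insert_erase hm⟩
    simp only [mem_sigma, mem_powerset, subset_iff, mem_erase, mem_Ioo]
    exact ⟨mem_Ioo.1 (hS.2 hm), fun x hx => ⟨(mem_Ioo.1 (hS.2 hx.2)).1,
      lt_of_le_of_ne (S.le_max' x hx.2) hx.1⟩⟩

/-- The signed sum of left-nested words over all increasing chains from `i` to `j`. -/
def chainSum (Rt : A → A) (α : Matrix (Fin n) (Fin n) A) (i j : Fin n) : A :=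
  ∑ S ∈ (Ioo i j).powerset, (-1 : A) ^ (S.card + 1) * nestedL Rt α i (S.sort (· ≤ ·)) j

theorem chainSum_eq (f : A →+ A) (α : Matrix (Fin n) (Fin n) A) (i j : Fin n) :
    chainSum f α i j = -f (α i j + ∑ k ∈ Ioo i j, chainSum f α i k * α k j) := by
  have hsign (m : ℕ) (x : A) : f ((-1) ^ m * x) = (-1) ^ m * f x := by
    rcases neg_one_pow_eq_or A m with h | h <;> simp [h]
  rw [chainSum, sum_powerset_Ioo_eq, map_add, neg_add]
  congr 1
  · simp [nestedL]
  · rw [map_sum, ← sum_neg_distrib]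
    refine sum_congr rfl fun k _ => ?_
    rw [chainSum, sum_mul, map_sum, ← sum_neg_distrib]
    refine sum_congr rfl fun S hS => ?_
    have hlt : ∀ x ∈ S, x < k := fun x hx => (mem_Ioo.1 (mem_powerset.1 hS hx)).2
    rw [card_insert_of_notMem fun hk => lt_irrefl _ (hlt k hk), sort_insert_of_forall_lt hlt,
      nestedL_append_singleton, mul_assoc, hsign, pow_succ _ (_ + 1)]
    ring

/-- The upper unitriangular matrix whose entries above the diagonal are the chain sums. -/
def chainMatrix (Rt : A → A) (α : Matrix (Fin n) (Fin n) A) : Matrix (Fin n) (Fin n) A :=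
  fun i j => if i < j then chainSum Rt α i j else (1 : Matrix (Fin n) (Fin n) A) i j

theorem chainMatrix_eq (f : A →+ A) (α : Matrix (Fin n) (Fin n) A) (i j : Fin n) :
    chainMatrix f α i j =
      (1 : Matrix (Fin n) (Fin n) A) i j - f (∑ k ∈ Iio j, chainMatrix f α i k * α k j) := by
  have hzero {k : Fin n} (hk : k < i) : chainMatrix f α i k = 0 := by
    simp [chainMatrix, hk.not_gt, hk.ne']
  rcases lt_or_ge i j with hij | hij
  · have hsum : ∑ k ∈ Iio j, chainMatrix f α i k * α k j =
        α i j + ∑ k ∈ Ioo i j, chainSum f α i k * α k j := by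
      have hsub : Ico i j ⊆ Iio j := fun k hk => mem_Iio.2 (mem_Ico.1 hk).2
      rw [← sum_subset hsub, ← Ioo_insert_left hij, sum_insert (by simp)]
      · congr 1
        · simp [chainMatrix]
        · exact sum_congr rfl fun k hk => by simp [chainMatrix, (mem_Ioo.1 hk).1]
      · intro k hk hk'
        rw [hzero, zero_mul]
        simpa [mem_Iio.1 hk] using hk'
    rw [hsum, ← neg_add_eq_sub, ← chainSum_eq]
    simp [chainMatrix, hij, hij.ne]
  · rw [sum_eq_zero fun k hk => by rw [hzero ((mem_Iio.1 hk).trans_le hij), zero_mul]]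
    simp [chainMatrix, hij.not_gt]

theorem matrix_eq_one_sub_map_iff (f : A →+ A) {α : Matrix (Fin n) (Fin n) A}
    (hα : ∀ i j : Fin n, j < i → α i j = 0) (hαdiag : ∀ i : Fin n, α i i = 1)
    (β : Matrix (Fin n) (Fin n) A) :
    β = 1 - (β * (α - 1)).map f ↔ β = chainMatrix f α := by
  have hentry : β = 1 - (β * (α - 1)).map f ↔
      ∀ i j, β i j = (1 : Matrix (Fin n) (Fin n) A) i j - f (∑ k ∈ Iio j, β i k * α k j) := by
    rw [← Matrix.ext_iff]
    refine forall_congr' fun i => forall_congr' fun j => ?_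
    have hsum : (β * (α - 1)) i j = ∑ k ∈ Iio j, β i k * α k j := by
      rw [Matrix.mul_apply, ← sum_subset (subset_univ (Iio j))]
      · exact sum_congr rfl fun k hk => by simp [(mem_Iio.1 hk).ne]
      · intro k _ hk
        rcases (not_lt.1 fun h => hk (mem_Iio.2 h)).eq_or_lt with rfl | h
        · simp [hαdiag]
        · simp [hα k j h, h.ne']
    rw [Matrix.sub_apply, Matrix.map_apply, hsum]
  rw [hentry]
  constructor
  · intro h
    ext i j
    induction j using WellFoundedLT.induction with
    | ind j ih =>
      rw [h, chainMatrix_eq]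
      congr 2
      exact sum_congr rfl fun k hk => by rw [ih k (mem_Iio.1 hk)]
  · rintro rfl
    exact chainMatrix_eq f α

end Helpers

/-- Let `(A,R)` be a commutative Rota–Baxter algebra of weight one,
`R̃ := id − R`, `n ≥ 1`, and `α ∈ M_n(A)` unipotent upper triangular. The equation
`β' = 1 − 𝓡̃(β'·(α − 1))` has a unique solution, whose entries are `0` below the
diagonal, `1` on the diagonal, and for `i < j` are given by the sum over all strictly
increasing chains `i < l₁ < ⋯ < l_{k−1} < j` (subsets `S ⊆ (i,j)` sorted increasingly) of
`(−1)^{k} R̃(R̃(⋯ R̃(R̃(α_{i l₁}) α_{l₁ l₂}) ⋯) α_{l_{k−1} j})`, i.e.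
`β'_{ij} = −R̃(α_{ij}) − Σ_{k=2}^{j−i} Σ_{i<l₁<⋯<l_{k−1}<j} (−1)^{k+1} R̃(R̃(⋯) α_{l_{k−1} j})`. -/
theorem matrix_renormalized_formula {K A : Type*} [Field K] [CharZero K]
    [CommRing A] [Algebra K A] (R : A →ₗ[K] A)
    (hR : ∀ x y : A, R x * R y + R (x * y) = R (R x * y + x * R y))
    (n : ℕ) (hn : 1 ≤ n)
    (α : Matrix (Fin n) (Fin n) A)
    (hα : ∀ i j : Fin n, j < i → α i j = 0)
    (hαdiag : ∀ i : Fin n, α i i = 1) :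
    (∃! β' : Matrix (Fin n) (Fin n) A,
        β' = 1 - (β' * (α - 1)).map (fun x => x - R x)) ∧
    (∀ β' : Matrix (Fin n) (Fin n) A,
      β' = 1 - (β' * (α - 1)).map (fun x => x - R x) →
      (∀ i j : Fin n, j < i → β' i j = 0) ∧
      (∀ i : Fin n, β' i i = 1) ∧
      (∀ i j : Fin n, i < j →
        β' i j = ∑ S ∈ (Finset.Ioo i j).powerset,
          (-1 : A) ^ (S.card + 1) *
            nestedL (fun x => x - R x) α i (S.sort (· ≤ ·)) j)) := by
  have key := matrix_eq_one_sub_map_iff (LinearMap.id - R : A →ₗ[K] A).toAddMonoidHom hα hαdiag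
  have hf : ⇑(LinearMap.id - R : A →ₗ[K] A).toAddMonoidHom = fun x => x - R x := rfl
  rw [hf] at key
  refine ⟨⟨_, (key _).2 rfl, fun β hβ => (key β).1 hβ⟩, fun β hβ => ?_⟩
  rw [(key β).1 hβ]
  refine ⟨fun i j h => ?_, fun i => ?_, fun i j h => ?_⟩
  · simp [chainMatrix, h.not_gt, h.ne']
  · simp [chainMatrix]
  · simp [chainMatrix, chainSum, h]
end
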